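/- arXiv:1512.02600 — 3 statements merged into one kernel-verified Lean document; each statement's English description precedes it below -/
import Mathlib

section
/- There is a constant C ≥ 1 depending only on the doubling constant C_d such that for any set A ⊂ X and any ball B(x,r), relcap₁(A ∩ B(x,r), B(x,2r)) ≤ C H(A ∩ B(x,r)), where H is the codimension-1 Hausdorff measure. -/
open MeasureTheory Metric Set Filter Topology ENNReal NNReal

noncomputable section

namespace FineBV

variable {X : Type*} [MetricSpace X] [MeasurableSpace X]

/-- `g` is an upper gradient of `u` on `Ω`: for every `1`-Lipschitz
(arclength-parametrized) curve `γ : [0, ℓ] → X` with image in `Ω`,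
`|u (γ ℓ) - u (γ 0)| ≤ ∫_0^ℓ g (γ t) dt`. -/
def IsUpperGradientOn (g : X → ℝ≥0∞) (u : X → ℝ) (Ω : Set X) : Prop :=
  Measurable g ∧
    ∀ (ℓ : ℝ), 0 ≤ ℓ → ∀ γ : ℝ → X, LipschitzOnWith 1 γ (Icc 0 ℓ) →
      (∀ t ∈ Icc (0:ℝ) ℓ, γ t ∈ Ω) →
      ENNReal.ofReal |u (γ ℓ) - u (γ 0)| ≤ ∫⁻ t in Icc (0:ℝ) ℓ, g (γ t)

/-- `g` is an upper gradient of `u` on all of `X`. -/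
def IsUpperGradient (g : X → ℝ≥0∞) (u : X → ℝ) : Prop :=
  IsUpperGradientOn g u univ

/-- The (extended) `L¹` norm. -/
def eL1Norm (μ : Measure X) (u : X → ℝ) : ℝ≥0∞ :=
  ∫⁻ x, ENNReal.ofReal |u x| ∂μ

/-- The (extended) Newtonian `N^{1,1}` norm. -/
def eN11Norm (μ : Measure X) (u : X → ℝ) : ℝ≥0∞ :=
  eL1Norm μ u + ⨅ (g : X → ℝ≥0∞) (_ : IsUpperGradient g u), ∫⁻ x, g x ∂μ

/-- Membership in the Newtonian space `N^{1,1}(X)`. -/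
def MemN11 (μ : Measure X) (u : X → ℝ) : Prop :=
  Measurable u ∧ eN11Norm μ u < ⊤

/-- The `1`-capacity of a set. -/
def capacity1 (μ : Measure X) (A : Set X) : ℝ≥0∞ :=
  ⨅ (u : X → ℝ) (_ : MemN11 μ u) (_ : ∀ x ∈ A, 1 ≤ u x), eN11Norm μ u

/-- The relative (variational) `1`-capacity of `A` with respect to `Ω`. -/
def relCapacity1 (μ : Measure X) (A Ω : Set X) : ℝ≥0∞ :=
  ⨅ (u : X → ℝ) (_ : MemN11 μ u) (g : X → ℝ≥0∞) (_ : IsUpperGradient g u)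
    (_ : ∀ x ∈ A, 1 ≤ u x) (_ : ∀ x, x ∉ Ω → u x = 0),
    ∫⁻ x in Ω, g x ∂μ

/-- `A` is `1`-thin at `x`. -/
def OneThinAt (μ : Measure X) (A : Set X) (x : X) : Prop :=
  Tendsto (fun r : ℝ =>
      ENNReal.ofReal r * relCapacity1 μ (A ∩ ball x r) (ball x (2 * r)) / μ (ball x r))
    (𝓝[>] 0) (𝓝 0)

/-- `U` is `1`-finely open. -/
def OneFinelyOpen (μ : Measure X) (U : Set X) : Prop :=
  ∀ x ∈ U, OneThinAt μ Uᶜ x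

/-- `F` is `1`-finely closed. -/
def OneFinelyClosed (μ : Measure X) (F : Set X) : Prop :=
  OneFinelyOpen μ Fᶜ

/-- The `1`-fine closure: the smallest `1`-finely closed set containing `G`. -/
def oneFineClosure (μ : Measure X) (G : Set X) : Set X :=
  ⋂₀ {F : Set X | G ⊆ F ∧ OneFinelyClosed μ F}

/-- `μ` is doubling with constant `Cd`: balls have positive finite measure and
`μ(B(x,2r)) ≤ Cd · μ(B(x,r))`. -/
def DoublingWith (μ : Measure X) (Cd : ℝ≥0) : Prop :=
  ∀ (x : X) (r : ℝ), 0 < r →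
    0 < μ (ball x r) ∧ μ (ball x (2 * r)) ≤ (Cd : ℝ≥0∞) * μ (ball x r) ∧ μ (ball x r) < ⊤

/-- `u` is Lipschitz on compact subsets of `Ω` (locally Lipschitz in `Ω`). -/
def LocLipschitzOn (u : X → ℝ) (Ω : Set X) : Prop :=
  ∀ K : Set X, K ⊆ Ω → IsCompact K → ∃ L : ℝ≥0, LipschitzOnWith L u K

/-- The total variation `‖Du‖(Ω)`. -/
def totalVariation (μ : Measure X) (u : X → ℝ) (Ω : Set X) : ℝ≥0∞ :=
  ⨅ (v : ℕ → X → ℝ) (g : ℕ → X → ℝ≥0∞)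
    (_ : ∀ i, LocLipschitzOn (v i) Ω)
    (_ : ∀ i, IsUpperGradientOn (g i) (v i) Ω)
    (_ : ∀ K : Set X, K ⊆ Ω → IsCompact K →
        Tendsto (fun i => ∫⁻ x in K, ENNReal.ofReal |v i x - u x| ∂μ) atTop (𝓝 0)),
    Filter.atTop.liminf fun i => ∫⁻ x in Ω, g i x ∂μ

/-- The perimeter `P(E,Ω) = ‖Dχ_E‖(Ω)`. -/
def perimeter (μ : Measure X) (E Ω : Set X) : ℝ≥0∞ :=
  totalVariation μ (Set.indicator E fun _ => (1 : ℝ)) Ω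

/-- `u ∈ BV(X)`. -/
def MemBV (μ : Measure X) (u : X → ℝ) : Prop :=
  Integrable u μ ∧ totalVariation μ u univ < ⊤

/-- The (extended) `BV` norm. -/
def eBVNorm (μ : Measure X) (u : X → ℝ) : ℝ≥0∞ :=
  eL1Norm μ u + totalVariation μ u univ

/-- The `(1,1)`-Poincaré inequality with constants `CP`, `lam`. -/
def PoincareIneq (μ : Measure X) (CP lam : ℝ) : Prop :=
  ∀ (x : X) (r : ℝ), 0 < r → ∀ (u : X → ℝ) (g : X → ℝ≥0∞),
    LocallyIntegrable u μ → IsUpperGradient g u →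
    (∫⁻ y in ball x r, ENNReal.ofReal |u y - ⨍ z in ball x r, u z ∂μ| ∂μ) / μ (ball x r)
      ≤ ENNReal.ofReal (CP * r) * ((∫⁻ y in ball x (lam * r), g y ∂μ) / μ (ball x (lam * r)))

/-- The restricted spherical Hausdorff content of codimension 1, at scale `R`. -/
def codimHContent (μ : Measure X) (R : ℝ) (A : Set X) : ℝ≥0∞ :=
  ⨅ (c : ℕ → X) (r : ℕ → ℝ) (_ : ∀ i, 0 < r i ∧ r i ≤ R)
    (_ : A ⊆ ⋃ i, ball (c i) (r i)),
    ∑' i, μ (ball (c i) (r i)) / ENNReal.ofReal (r i)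

/-- The codimension 1 Hausdorff measure `H(A) = lim_{R→0⁺} H_R(A)`. -/
def codimH (μ : Measure X) (A : Set X) : ℝ≥0∞ :=
  ⨆ (R : ℝ) (_ : 0 < R), codimHContent μ R A

/-- The measure-theoretic interior `I_E`. -/
def measInterior (μ : Measure X) (E : Set X) : Set X :=
  {x | Tendsto (fun r : ℝ => μ (ball x r \ E) / μ (ball x r)) (𝓝[>] 0) (𝓝 0)}

/-- The measure-theoretic boundary `∂*E`. -/
def measBoundary (μ : Measure X) (E : Set X) : Set X :=
  {x | 0 < limsup (fun r : ℝ => μ (ball x r ∩ E) / μ (ball x r)) (𝓝[>] 0) ∧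
       0 < limsup (fun r : ℝ => μ (ball x r \ E) / μ (ball x r)) (𝓝[>] 0)}

/-- The lower approximate limit `u^∧`. -/
def lowerApprox (μ : Measure X) (u : X → ℝ) (x : X) : EReal :=
  sSup {t : EReal |
    Tendsto (fun r : ℝ => μ (ball x r ∩ {y | (u y : EReal) < t}) / μ (ball x r))
      (𝓝[>] 0) (𝓝 0)}

/-- The upper approximate limit `u^∨`. -/
def upperApprox (μ : Measure X) (u : X → ℝ) (x : X) : EReal :=
  sInf {t : EReal |
    Tendsto (fun r : ℝ => μ (ball x r ∩ {y | t < (u y : EReal)}) / μ (ball x r))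
      (𝓝[>] 0) (𝓝 0)}

/-- The next jump value after the value `p` at `x`. -/
def jumpNext (μ : Measure X) (u : X → ℝ) (p : EReal) (x : X) : EReal :=
  sSup {t : EReal | ∀ δ : ℝ, 0 < δ →
    Tendsto (fun r : ℝ =>
        μ (ball x r ∩ {y | p + (δ : EReal) < (u y : EReal) ∧ (u y : EReal) < t}) /
          μ (ball x r))
      (𝓝[>] 0) (𝓝 0)}

/-- Auxiliary jump values: `jumpAux μ u (l-1)` is the `l`-th jump value for `l < n`. -/
def jumpAux (μ : Measure X) (u : X → ℝ) : ℕ → X → EReal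
  | 0 => lowerApprox μ u
  | (l + 1) => fun x =>
      if jumpAux μ u l x < upperApprox μ u x then jumpNext μ u (jumpAux μ u l x) x
      else upperApprox μ u x

/-- The jump values `u^l`, `l = 1, …, n`, with `u^1 = u^∧` and `u^n = u^∨`. -/
def jumpVal (μ : Measure X) (u : X → ℝ) (n l : ℕ) : X → EReal :=
  if l = n then upperApprox μ u else jumpAux μ u (l - 1)

/-- The extended absolute difference `|a - b|` of two extended reals, with the
convention that it is `∞` whenever exactly one of them is infinite or they are
distinct infinities, and `0` when `a = b`. -/
def eAbsDiff (a b : EReal) : ℝ≥0∞ :=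
  if a = b then 0
  else if a = ⊤ ∨ a = ⊥ ∨ b = ⊤ ∨ b = ⊥ then ⊤
  else ENNReal.ofReal |a.toReal - b.toReal|

/-- `γ` satisfies the density-bound property: for every set of finite perimeter `E`,
`H`-a.e. point of `∂*E` has lower density `≥ γ` and upper density `≤ 1 - γ`. -/
def GammaDensityProperty (μ : Measure X) (γ : ℝ) : Prop :=
  ∀ E : Set X, MeasurableSet E → perimeter μ E univ < ⊤ →
    codimH μ {x ∈ measBoundary μ E |
      ¬ (ENNReal.ofReal γ ≤
            Filter.liminf (fun r : ℝ => μ (ball x r ∩ E) / μ (ball x r)) (𝓝[>] 0) ∧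
          Filter.limsup (fun r : ℝ => μ (ball x r ∩ E) / μ (ball x r)) (𝓝[>] 0) ≤
            ENNReal.ofReal (1 - γ))} = 0

/-- `v` is a discrete convolution of `u` at scale `R` (with dilation parameter `lam`). -/
def IsDiscreteConvolution (μ : Measure X) (lam R : ℝ) (u v : X → ℝ) : Prop :=
  ∃ (c : ℕ → X) (φ : ℕ → X → ℝ),
    (∀ z : X, ∃ j, z ∈ ball (c j) R) ∧
    (∃ C₀ : ℕ, ∀ k : ℕ,
      {j : ℕ | (ball (c j) (10 * lam * R) ∩ ball (c k) (10 * lam * R)).Nonempty}.Finite ∧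
      {j : ℕ | (ball (c j) (10 * lam * R) ∩ ball (c k) (10 * lam * R)).Nonempty}.ncard ≤ C₀) ∧
    (∀ j z, 0 ≤ φ j z ∧ φ j z ≤ 1) ∧
    (∃ L : ℝ≥0, ∀ j, LipschitzWith (L * (Real.toNNReal R)⁻¹) (φ j)) ∧
    (∀ j, tsupport (φ j) ⊆ ball (c j) (2 * R)) ∧
    (∀ z : X, HasSum (fun j => φ j z) 1) ∧
    (∀ z : X, v z = ∑' j, (⨍ y in ball (c j) (5 * R), u y ∂μ) * φ j z)

/-- The cutoff function equal to `1` on `ball c ρ` and to `0` outside `ball c (2 * ρ)`. -/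
def ballCutoff {Y : Type*} [MetricSpace Y] (c : Y) (ρ : ℝ) (y : Y) : ℝ :=
  max 0 (min 1 (2 - ρ⁻¹ * dist y c))

section BallCutoff

variable {Y : Type*} [MetricSpace Y] {c : Y} {ρ : ℝ}

lemma ballCutoff_nonneg (y : Y) : 0 ≤ ballCutoff c ρ y := le_max_left _ _

lemma ballCutoff_le_one (y : Y) : ballCutoff c ρ y ≤ 1 :=
  max_le zero_le_one (min_le_left _ _)

lemma one_le_ballCutoff (hρ : 0 < ρ) {y : Y} (hy : y ∈ ball c ρ) : 1 ≤ ballCutoff c ρ y := by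
  have h : ρ⁻¹ * dist y c ≤ 1 := by
    rw [inv_mul_le_iff₀ hρ, mul_one]
    exact (mem_ball.1 hy).le
  exact le_max_of_le_right (le_min le_rfl (by linarith))

lemma mem_ball_of_ballCutoff_pos (hρ : 0 < ρ) {y : Y} (hy : 0 < ballCutoff c ρ y) :
    y ∈ ball c (2 * ρ) := by
  have h : 0 < 2 - ρ⁻¹ * dist y c :=
    ((lt_max_iff.1 hy).resolve_left (lt_irrefl _)).trans_le (min_le_right _ _)
  have h' : ρ⁻¹ * dist y c < 2 := by linarith
  rw [inv_mul_lt_iff₀ hρ] at h'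
  rw [mem_ball]
  linarith

lemma lipschitzWith_ballCutoff : LipschitzWith (Real.toNNReal ρ⁻¹) (ballCutoff c ρ) := by
  by_cases hρ : 0 ≤ ρ⁻¹
  · refine LipschitzWith.const_max (LipschitzWith.const_min (LipschitzWith.of_dist_le_mul ?_) 1) 0
    intro a b
    rw [Real.dist_eq, Real.coe_toNNReal _ hρ]
    have h := abs_dist_sub_le b a c
    calc |2 - ρ⁻¹ * dist a c - (2 - ρ⁻¹ * dist b c)|
        = ρ⁻¹ * |dist b c - dist a c| := by
          rw [← abs_of_nonneg hρ, ← abs_mul, abs_of_nonneg hρ]; congr 1; ring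
      _ ≤ ρ⁻¹ * dist a b := by rw [dist_comm a b]; gcongr
  · have h (y : Y) : ballCutoff c ρ y = 1 := by
      have : ρ⁻¹ * dist y c ≤ 0 :=
        mul_nonpos_of_nonpos_of_nonneg (not_le.1 hρ).le dist_nonneg
      rw [ballCutoff, min_eq_left (by linarith), max_eq_right zero_le_one]
    exact LipschitzWith.of_dist_le_mul fun a b => by
      rw [h, h, dist_self]; positivity

end BallCutoff

/-- A nonnegative function which is `K`-Lipschitz on `[0, ℓ]` oscillates between the endpoints
by at most `K` times the length of the set where it is positive. -/
lemma ofReal_abs_sub_le_mul_volume_pos {f : ℝ → ℝ} {K : ℝ≥0} {ℓ : ℝ} (hℓ : 0 ≤ ℓ)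
    (hf : LipschitzOnWith K f (Icc 0 ℓ)) (h0 : ∀ t, 0 ≤ f t) :
    ENNReal.ofReal |f ℓ - f 0| ≤ K * volume {t ∈ Icc 0 ℓ | 0 < f t} := by
  set S := {t ∈ Icc 0 ℓ | 0 < f t}
  have hsub : uIoc (f 0) (f ℓ) ⊆ f '' S := by
    intro y hy
    have hcont : ContinuousOn f (uIcc 0 ℓ) := by
      rw [uIcc_of_le hℓ]; exact hf.continuousOn
    obtain ⟨t, ht, rfl⟩ := intermediate_value_uIcc hcont (uIoc_subset_uIcc hy)
    rw [uIcc_of_le hℓ] at ht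
    exact ⟨t, ⟨ht, (le_min (h0 0) (h0 ℓ)).trans_lt hy.1⟩, rfl⟩
  have himage := (hf.mono (sep_subset _ _ : S ⊆ Icc 0 ℓ)).hausdorffMeasure_image_le zero_le_one
  rw [hausdorffMeasure_real, ENNReal.rpow_one] at himage
  calc ENNReal.ofReal |f ℓ - f 0| = volume (uIoc (f 0) (f ℓ)) := by rw [Real.volume_uIoc]
    _ ≤ volume (f '' S) := measure_mono hsub
    _ ≤ K * volume S := himage

/-- A nonnegative `K`-Lipschitz function vanishing outside a measurable set `B` has the upper
gradient `K · χ_B`. -/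
lemma isUpperGradient_indicator_of_lipschitzWith [BorelSpace X] {u : X → ℝ} {K : ℝ≥0} {B : Set X}
    (hu : LipschitzWith K u) (h0 : ∀ y, 0 ≤ u y) (hB : MeasurableSet B)
    (hpos : ∀ y, 0 < u y → y ∈ B) :
    IsUpperGradient (B.indicator fun _ => (K : ℝ≥0∞)) u := by
  have hmeas : Measurable (B.indicator fun _ : X => (K : ℝ≥0∞)) := measurable_const.indicator hB
  refine ⟨hmeas, fun ℓ hℓ γ hγ _ => ?_⟩
  have hf : LipschitzOnWith K (u ∘ γ) (Icc 0 ℓ) := by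
    simpa using hu.comp_lipschitzOnWith hγ
  have hγm : AEMeasurable γ (volume.restrict (Icc 0 ℓ)) :=
    hγ.continuousOn.aemeasurable measurableSet_Icc
  calc ENNReal.ofReal |u (γ ℓ) - u (γ 0)|
      ≤ K * volume {t ∈ Icc 0 ℓ | 0 < u (γ t)} :=
        ofReal_abs_sub_le_mul_volume_pos hℓ hf fun t => h0 _
    _ ≤ K * volume.restrict (Icc 0 ℓ)
          {t | (K : ℝ≥0∞) ≤ B.indicator (fun _ => (K : ℝ≥0∞)) (γ t)} := by
        refine mul_le_mul_right ?_ _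
        rw [Measure.restrict_apply' measurableSet_Icc]
        refine measure_mono fun t ht => ⟨?_, ht.1⟩
        rw [mem_ofPred_eq, indicator_of_mem (hpos _ ht.2)]
    _ ≤ ∫⁻ t in Icc (0:ℝ) ℓ, B.indicator (fun _ => (K : ℝ≥0∞)) (γ t) :=
        mul_meas_ge_le_lintegral₀ (hmeas.comp_aemeasurable hγm) _

/-- The supremum of a pointwise bounded sequence of functions has the sum of their upper gradients
as an upper gradient. -/
lemma IsUpperGradient.iSup_tsum {u : ℕ → X → ℝ} {g : ℕ → X → ℝ≥0∞}
    (hg : ∀ i, IsUpperGradient (g i) (u i)) (hbdd : ∀ y, BddAbove (range fun i => u i y)) :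
    IsUpperGradient (fun y => ∑' i, g i y) (fun y => ⨆ i, u i y) := by
  refine ⟨Measurable.tsum fun i => (hg i).1, fun ℓ hℓ γ hγ hΩ => ?_⟩
  set T := ∫⁻ t in Icc (0:ℝ) ℓ, ∑' i, g i (γ t)
  by_cases hT : T = ⊤
  · rw [hT]; exact le_top
  have key (i : ℕ) : |u i (γ ℓ) - u i (γ 0)| ≤ T.toReal := by
    rw [← ENNReal.ofReal_le_iff_le_toReal hT]
    exact ((hg i).2 ℓ hℓ γ hγ hΩ).trans (lintegral_mono fun t => ENNReal.le_tsum i)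
  rw [ENNReal.ofReal_le_iff_le_toReal hT, abs_sub_le_iff, sub_le_iff_le_add, sub_le_iff_le_add]
  constructor
  · refine ciSup_le fun i => ?_
    have h1 := (abs_sub_le_iff.1 (key i)).1
    have h2 := le_ciSup (hbdd (γ 0)) i
    dsimp only at h1 h2 ⊢
    linarith
  · refine ciSup_le fun i => ?_
    have h1 := (abs_sub_le_iff.1 (key i)).2
    have h2 := le_ciSup (hbdd (γ ℓ)) i
    dsimp only at h1 h2 ⊢
    linarith

/-- A measurable function bounded by `1`, supported in a set of finite measure and having an
integrable upper gradient, belongs to the Newtonian space. -/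
lemma memN11_of_le_one {μ : Measure X} {u : X → ℝ} {g : X → ℝ≥0∞} {Ω : Set X}
    (hu : Measurable u) (h0 : ∀ y, 0 ≤ u y) (h1 : ∀ y, u y ≤ 1) (hΩ : ∀ y, y ∉ Ω → u y = 0)
    (hμΩ : μ Ω < ⊤) (hg : IsUpperGradient g u) (hgint : ∫⁻ y, g y ∂μ < ⊤) : MemN11 μ u := by
  refine ⟨hu, ENNReal.add_lt_top.2 ⟨?_, (iInf₂_le g hg).trans_lt hgint⟩⟩
  calc eL1Norm μ u ≤ ∫⁻ y, Ω.indicator (fun _ => (1 : ℝ≥0∞)) y ∂μ := by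
        refine lintegral_mono fun y => ?_
        by_cases hy : y ∈ Ω
        · rw [indicator_of_mem hy, abs_of_nonneg (h0 y)]
          exact ENNReal.ofReal_le_one.2 (h1 y)
        · simp [hΩ y hy]
    _ ≤ 1 * μ Ω := lintegral_indicator_const_le Ω 1
    _ < ⊤ := by rwa [one_mul]

/-- The relative capacity of a set in `ball x r` is controlled by any covering with small balls. -/
lemma relCapacity1_le_tsum_cover [BorelSpace X] {μ : Measure X} {Cd : ℝ≥0} (hCd : 1 ≤ Cd)
    (hμ : DoublingWith μ Cd) {E : Set X} {x : X} {r : ℝ} (hr : 0 < r) (hE : E ⊆ ball x r)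
    {c : ℕ → X} {ρ : ℕ → ℝ} (hρ : ∀ i, 0 < ρ i ∧ ρ i ≤ r / 4)
    (hcover : E ⊆ ⋃ i, ball (c i) (ρ i)) :
    relCapacity1 μ E (ball x (2 * r)) ≤
      (Cd : ℝ≥0∞) * ∑' i, μ (ball (c i) (ρ i)) / ENNReal.ofReal (ρ i) := by
  classical
  by_cases hsum : ∑' i, μ (ball (c i) (ρ i)) / ENNReal.ofReal (ρ i) = ⊤
  · rw [hsum, ENNReal.mul_top (by simpa using (zero_lt_one.trans_le hCd).ne')]
    exact le_top
  let P : ℕ → Prop := fun i => (ball (c i) (ρ i) ∩ ball x r).Nonempty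
  let v : ℕ → X → ℝ := fun i => if P i then ballCutoff (c i) (ρ i) else fun _ => 0
  let g : ℕ → X → ℝ≥0∞ := fun i =>
    (ball (c i) (2 * ρ i)).indicator fun _ => (Real.toNNReal (ρ i)⁻¹ : ℝ≥0∞)
  have hv0 (i : ℕ) (y : X) : 0 ≤ v i y := by
    by_cases hi : P i <;> simp [v, hi, ballCutoff_nonneg]
  have hv1 (i : ℕ) (y : X) : v i y ≤ 1 := by
    by_cases hi : P i <;> simp [v, hi, ballCutoff_le_one]
  have hvlip (i : ℕ) : LipschitzWith (Real.toNNReal (ρ i)⁻¹) (v i) := by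
    by_cases hi : P i
    · simpa only [v, if_pos hi] using lipschitzWith_ballCutoff
    · simpa only [v, if_neg hi] using (LipschitzWith.const (0 : ℝ)).weaken zero_le
  have hvpos (i : ℕ) (y : X) (hy : 0 < v i y) : P i ∧ y ∈ ball (c i) (2 * ρ i) := by
    by_cases hi : P i
    · simp only [v, if_pos hi] at hy
      exact ⟨hi, mem_ball_of_ballCutoff_pos (hρ i).1 hy⟩
    · simp [v, hi] at hy
  have hbdd (y : X) : BddAbove (range fun i => v i y) :=
    ⟨1, forall_mem_range.2 fun i => hv1 i y⟩
  have hg : IsUpperGradient (fun y => ∑' i, g i y) (fun y => ⨆ i, v i y) :=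
    IsUpperGradient.iSup_tsum (fun i => isUpperGradient_indicator_of_lipschitzWith (hvlip i)
      (hv0 i) measurableSet_ball fun y hy => (hvpos i y hy).2) hbdd
  have hgint : ∫⁻ y, ∑' i, g i y ∂μ ≤
      (Cd : ℝ≥0∞) * ∑' i, μ (ball (c i) (ρ i)) / ENNReal.ofReal (ρ i) := by
    rw [lintegral_tsum fun i => (measurable_const.indicator measurableSet_ball).aemeasurable,
      ← ENNReal.tsum_mul_left]
    refine ENNReal.tsum_le_tsum fun i => ?_
    calc ∫⁻ y, g i y ∂μ = ENNReal.ofReal (ρ i)⁻¹ * μ (ball (c i) (2 * ρ i)) :=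
          lintegral_indicator_const measurableSet_ball _
      _ ≤ ENNReal.ofReal (ρ i)⁻¹ * (Cd * μ (ball (c i) (ρ i))) := by
          gcongr
          exact (hμ (c i) (ρ i) (hρ i).1).2.1
      _ = Cd * (μ (ball (c i) (ρ i)) / ENNReal.ofReal (ρ i)) := by
          rw [ENNReal.ofReal_inv_of_pos (hρ i).1, div_eq_mul_inv]
          ring
  have hsupp (y : X) (hy : y ∉ ball x (2 * r)) : ⨆ i, v i y = 0 := by
    have hzero (i : ℕ) : v i y = 0 := by
      by_contra hne
      obtain ⟨⟨z, hz, hzx⟩, hyc⟩ := hvpos i y ((hv0 i y).lt_of_ne' hne)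
      refine hy (mem_ball.2 ?_)
      rw [mem_ball] at hz hzx hyc
      have h1 := dist_triangle y (c i) x
      have h2 := dist_triangle_left (c i) x z
      linarith [(hρ i).2]
    simp [hzero]
  have hmem : MemN11 μ fun y => ⨆ i, v i y :=
    memN11_of_le_one (Measurable.iSup fun i => (hvlip i).continuous.measurable)
      (fun y => Real.iSup_nonneg fun i => hv0 i y) (fun y => ciSup_le fun i => hv1 i y) hsupp
      (hμ x (2 * r) (by positivity)).2.2 hg
      (hgint.trans_lt (ENNReal.mul_lt_top ENNReal.coe_lt_top (lt_top_iff_ne_top.2 hsum)))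
  have hone (y : X) (hy : y ∈ E) : 1 ≤ ⨆ i, v i y := by
    obtain ⟨i, hi⟩ := mem_iUnion.1 (hcover hy)
    have hPi : P i := ⟨y, hi, hE hy⟩
    refine le_trans ?_ (le_ciSup (hbdd y) i)
    simpa only [v, if_pos hPi] using one_le_ballCutoff (hρ i).1 hi
  calc relCapacity1 μ E (ball x (2 * r)) ≤ ∫⁻ y in ball x (2 * r), ∑' i, g i y ∂μ :=
        (iInf₂_le _ hmem).trans ((iInf₂_le (fun y => ∑' i, g i y) hg).trans (iInf₂_le hone hsupp))
    _ ≤ ∫⁻ y, ∑' i, g i y ∂μ := setLIntegral_le_lintegral _ _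
    _ ≤ _ := hgint

/-- There is a constant `C ≥ 1`, depending only on the doubling constant `Cd`,
such that `relcap₁(A ∩ B(x,r), B(x,2r)) ≤ C · H(A ∩ B(x,r))` for every set `A`
and every ball `B(x,r)`. -/
theorem relCapacity_le_codimH
    (Cd : ℝ≥0) (hCd : 1 ≤ Cd) :
    ∃ C : ℝ≥0, 1 ≤ C ∧
      ∀ (X : Type) [MetricSpace X] [CompleteSpace X] [Nontrivial X]
        [MeasurableSpace X] [BorelSpace X] (μ : Measure X),
        DoublingWith μ Cd →
        ∀ (A : Set X) (x : X) (r : ℝ), 0 < r →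
          relCapacity1 μ (A ∩ ball x r) (ball x (2 * r)) ≤
            (C : ℝ≥0∞) * codimH μ (A ∩ ball x r) := by
  refine ⟨Cd, hCd, fun X _ _ _ _ _ μ hμ A x r hr => ?_⟩
  have hCd0 : (Cd : ℝ≥0∞) ≠ 0 := by simpa using (zero_lt_one.trans_le hCd).ne'
  refine le_trans ?_ (mul_le_mul_right (le_iSup₂ (f := fun R (_ : 0 < R) =>
    codimHContent μ R (A ∩ ball x r)) (r / 4) (by positivity)) _)
  rw [mul_comm (Cd : ℝ≥0∞), ← ENNReal.div_le_iff_le_mul (Or.inl hCd0) (Or.inl ENNReal.coe_ne_top)]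
  refine le_iInf₂ fun c ρ => le_iInf₂ fun hρ hcover => ?_
  rw [ENNReal.div_le_iff_le_mul (Or.inl hCd0) (Or.inl ENNReal.coe_ne_top),
    mul_comm _ (Cd : ℝ≥0∞)]
  exact relCapacity1_le_tsum_cover hCd hμ hr inter_subset_right hρ hcover

end FineBV
end
end

section
/- There is a constant C ≥ 1 depending only on the doubling constant C_d and the Poincaré constants C_P, λ such that for every ball B(x,r) and every μ-measurable set E ⊂ X, min{ μ(B(x,r) ∩ E), μ(B(x,r) ∖ E) } ≤ C r P(E, B(x,λr)) (the relative isoperimetric inequality). -/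
open MeasureTheory Metric Set Filter Topology ENNReal NNReal

noncomputable section

namespace FineBV

variable {X : Type*} [MetricSpace X] [MeasurableSpace X]

variable {μ : Measure X} {Cd : ℝ≥0}

theorem DoublingWith.measure_ball_two_pow_mul_le (h : DoublingWith μ Cd) (y : X) {ρ : ℝ}
    (hρ : 0 < ρ) (n : ℕ) :
    μ (ball y (2 ^ n * ρ)) ≤ (Cd : ℝ≥0∞) ^ n * μ (ball y ρ) := by
  induction n with
  | zero => simp
  | succ n ih =>
    calc μ (ball y (2 ^ (n + 1) * ρ)) = μ (ball y (2 * (2 ^ n * ρ))) := by ring_nf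
      _ ≤ Cd * μ (ball y (2 ^ n * ρ)) := (h y _ (by positivity)).2.1
      _ ≤ Cd * ((Cd : ℝ≥0∞) ^ n * μ (ball y ρ)) := by gcongr
      _ = (Cd : ℝ≥0∞) ^ (n + 1) * μ (ball y ρ) := by ring

theorem DoublingWith.isLocallyFiniteMeasure (h : DoublingWith μ Cd) :
    IsLocallyFiniteMeasure μ :=
  ⟨fun y => ⟨ball y 1, ball_mem_nhds y one_pos, (h y 1 one_pos).2.2⟩⟩

/-- A separated subset of a ball is finite, for a doubling measure. -/
theorem DoublingWith.finite_of_pairwise_le_dist [OpensMeasurableSpace X]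
    (h : DoublingWith μ Cd) (x : X) {R ε : ℝ} (hR : 0 < R) (hε : 0 < ε) {s : Set X}
    (hs : s ⊆ closedBall x R) (hsep : s.Pairwise fun y z => ε ≤ dist y z) : s.Finite := by
  obtain ⟨n, hn⟩ := pow_unbounded_of_one_lt (2 * R / (ε / 2)) (one_lt_two (α := ℝ))
  have hn' : 2 * R ≤ 2 ^ n * (ε / 2) := (div_le_iff₀ (by positivity)).1 hn.le
  have hlow : ∀ y ∈ s, μ (ball x R) / (Cd : ℝ≥0∞) ^ n ≤ μ (ball y (ε / 2)) := fun y hy => by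
    refine ENNReal.div_le_of_le_mul' (le_trans (measure_mono ?_)
      (h.measure_ball_two_pow_mul_le y (half_pos hε) n))
    refine ball_subset_ball' ?_
    have := mem_closedBall'.1 (hs hy)
    linarith
  have hdisj : Pairwise (Function.onFun Disjoint fun y : s => ball (y : X) (ε / 2)) := fun y z hyz =>
    ball_disjoint_ball (by
      have : ε ≤ dist (y : X) z := hsep y.2 z.2 fun e => hyz (Subtype.ext e)
      linarith)
  have hunion : μ (⋃ y : s, ball (y : X) (ε / 2)) ≠ ⊤ := by
    refine ne_top_of_le_ne_top (h x (R + ε) (by positivity)).2.2.ne (measure_mono ?_)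
    refine iUnion_subset fun y => ball_subset_ball' ?_
    have := mem_closedBall.1 (hs y.2)
    linarith
  have hpos : 0 < μ (ball x R) / (Cd : ℝ≥0∞) ^ n :=
    ENNReal.div_pos (h x R hR).1.ne' (ENNReal.pow_ne_top ENNReal.coe_ne_top)
  have hfin := Measure.finite_const_le_meas_of_disjoint_iUnion μ hpos
    (fun y : s => measurableSet_ball) hdisj hunion
  have huniv : {y : s | μ (ball x R) / (Cd : ℝ≥0∞) ^ n ≤ μ (ball (y : X) (ε / 2))} = univ :=
    eq_univ_of_forall fun y => hlow y y.2
  rw [huniv] at hfin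
  exact Set.finite_coe_iff.1 (Set.finite_univ_iff.1 hfin)

theorem DoublingWith.totallyBounded_closedBall [OpensMeasurableSpace X]
    (h : DoublingWith μ Cd) (x : X) {R : ℝ} (hR : 0 < R) :
    TotallyBounded (closedBall x R) := by
  refine Metric.totallyBounded_iff.2 fun ε hε => ?_
  obtain ⟨t, ht⟩ := zorn_subset
    {s : Set X | s ⊆ closedBall x R ∧ s.Pairwise fun y z => ε ≤ dist y z} fun c hc hchain =>
      ⟨⋃₀ c, ⟨sUnion_subset fun s hs => (hc hs).1,
        (pairwise_sUnion hchain.directedOn).2 fun s hs => (hc hs).2⟩,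
        fun s hs => subset_sUnion_of_mem hs⟩
  refine ⟨t, h.finite_of_pairwise_le_dist x hR hε ht.prop.1 ht.prop.2, fun y hy => ?_⟩
  by_contra hcov
  simp only [mem_iUnion, mem_ball, exists_prop, not_exists, not_and, not_lt] at hcov
  have hmem : insert y t ∈
      {s : Set X | s ⊆ closedBall x R ∧ s.Pairwise fun y z => ε ≤ dist y z} := by
    refine ⟨insert_subset hy ht.prop.1, ht.prop.2.insert fun z hz _ => ⟨hcov z hz, ?_⟩⟩
    rw [dist_comm]
    exact hcov z hz
  have hyt : y ∈ t := ht.le_of_ge hmem (subset_insert y t) (mem_insert y t)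
  have := hcov y hyt
  rw [dist_self] at this
  exact absurd this (not_le.2 hε)

theorem DoublingWith.isCompact_closedBall [CompleteSpace X] [OpensMeasurableSpace X]
    (h : DoublingWith μ Cd) (x : X) {R : ℝ} (hR : 0 < R) : IsCompact (closedBall x R) :=
  (h.totallyBounded_closedBall x hR).isCompact_of_isClosed isClosed_closedBall

/-- A function with an upper gradient on `Ω`, cut off to a closed set `K ⊆ Ω`, has an upper
gradient on the whole space which is infinite off `K`. -/
theorem IsUpperGradientOn.indicator [OpensMeasurableSpace X] {g : X → ℝ≥0∞} {u : X → ℝ}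
    {Ω K : Set X} (h : IsUpperGradientOn g u Ω) (hK : IsClosed K) (hKΩ : K ⊆ Ω) :
    IsUpperGradient (fun y => g y + Kᶜ.indicator (fun _ => ⊤) y) (K.indicator u) := by
  refine ⟨h.1.add (measurable_const.indicator hK.measurableSet.compl), ?_⟩
  intro ℓ hℓ γ hγ _
  by_cases hγK : ∀ t ∈ Icc (0 : ℝ) ℓ, γ t ∈ K
  · rw [indicator_of_mem (hγK ℓ (right_mem_Icc.2 hℓ)),
      indicator_of_mem (hγK 0 (left_mem_Icc.2 hℓ))]
    exact (h.2 ℓ hℓ γ hγ fun t ht => hKΩ (hγK t ht)).trans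
      (lintegral_mono fun t => le_self_add)
  rcases hℓ.eq_or_lt with rfl | hℓ
  · simp
  push Not at hγK
  obtain ⟨t, ht, htK⟩ := hγK
  have hnhds : {a | γ a ∈ Kᶜ} ∈ 𝓝[Icc 0 ℓ] t :=
    (hγ.continuousOn t ht) (hK.isOpen_compl.mem_nhds htK)
  obtain ⟨ε, hε, hsub⟩ := Metric.mem_nhdsWithin_iff.1 hnhds
  have hlt : max 0 (t - ε) < min ℓ (t + ε) := by
    simp only [lt_min_iff, max_lt_iff]
    refine ⟨⟨hℓ, ?_⟩, ?_, ?_⟩ <;> linarith [ht.1, ht.2]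
  have hIoo : ∀ a ∈ Ioo (max 0 (t - ε)) (min ℓ (t + ε)), a ∈ Icc 0 ℓ ∧ γ a ∈ Kᶜ := by
    intro a ha
    simp only [mem_Ioo, max_lt_iff, lt_min_iff] at ha
    have haI : a ∈ Icc 0 ℓ := ⟨ha.1.1.le, ha.2.1.le⟩
    refine ⟨haI, hsub ⟨?_, haI⟩⟩
    rw [Real.ball_eq_Ioo]
    exact ⟨ha.1.2, ha.2.2⟩
  refine le_top.trans ?_
  calc (⊤ : ℝ≥0∞)
      = ∫⁻ _ in Ioo (max 0 (t - ε)) (min ℓ (t + ε)), ⊤ := by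
        rw [setLIntegral_const, Real.volume_Ioo, ENNReal.top_mul]
        exact (ENNReal.ofReal_pos.2 (sub_pos.2 hlt)).ne'
    _ ≤ ∫⁻ a in Ioo (max 0 (t - ε)) (min ℓ (t + ε)),
          (g (γ a) + Kᶜ.indicator (fun _ => ⊤) (γ a)) := by
        refine setLIntegral_mono' measurableSet_Ioo fun a ha => ?_
        rw [indicator_of_mem (hIoo a ha).2, add_top]
    _ ≤ _ := lintegral_mono_set fun a ha => (hIoo a ha).1

/-- The Poincaré inequality for functions that are only defined on a neighbourhood of a closed
ball. -/
theorem PoincareIneq.exists_lintegral_sub_const_le [CompleteSpace X] [BorelSpace X]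
    {CP lam : ℝ} (hP : PoincareIneq μ CP lam) (h : DoublingWith μ Cd) (hlam : 1 ≤ lam)
    {x : X} {s : ℝ} (hs : 0 < s) {Ω : Set X} (hΩ : closedBall x (lam * s) ⊆ Ω)
    {v : X → ℝ} {g : X → ℝ≥0∞} (hv : LocLipschitzOn v Ω) (hg : IsUpperGradientOn g v Ω) :
    ∃ c : ℝ, ∫⁻ y in ball x s, ENNReal.ofReal |v y - c| ∂μ ≤
      ENNReal.ofReal (CP * s) * ∫⁻ y in Ω, g y ∂μ := by
  have := h.isLocallyFiniteMeasure
  have hls : 0 < lam * s := by positivity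
  set K := closedBall x (lam * s) with hK_def
  have hK : IsCompact K := h.isCompact_closedBall x hls
  obtain ⟨L, hL⟩ := hv K hΩ hK
  have hint : LocallyIntegrable (K.indicator v) μ :=
    ((integrable_indicator_iff hK.measurableSet).2
      (hL.continuousOn.integrableOn_compact hK)).locallyIntegrable
  have hpoinc := hP x s hs _ _ hint (hg.indicator hK.isClosed hΩ)
  have hball : ball x s ⊆ ball x (lam * s) := ball_subset_ball (by nlinarith)
  refine ⟨⨍ z in ball x s, K.indicator v z ∂μ, ?_⟩
  set c := ⨍ z in ball x s, K.indicator v z ∂μ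
  have hleft : ∫⁻ y in ball x s, ENNReal.ofReal |K.indicator v y - c| ∂μ =
      ∫⁻ y in ball x s, ENNReal.ofReal |v y - c| ∂μ :=
    setLIntegral_congr_fun measurableSet_ball fun y hy => by
      have hy' : y ∈ K := ball_subset_closedBall (hball hy)
      simp only [indicator_of_mem hy']
  have hright : ∫⁻ y in ball x (lam * s), (g y + Kᶜ.indicator (fun _ => ⊤) y) ∂μ =
      ∫⁻ y in ball x (lam * s), g y ∂μ :=
    setLIntegral_congr_fun measurableSet_ball fun y hy => by
      have hy' : y ∉ Kᶜ := not_not.2 (ball_subset_closedBall hy)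
      simp only [indicator_of_notMem hy', add_zero]
  rw [hleft, hright, ENNReal.div_le_iff (h x s hs).1.ne' (h x s hs).2.2.ne] at hpoinc
  refine hpoinc.trans ?_
  rw [mul_assoc]
  gcongr
  calc (∫⁻ y in ball x (lam * s), g y ∂μ) / μ (ball x (lam * s)) * μ (ball x s)
      ≤ (∫⁻ y in ball x (lam * s), g y ∂μ) / μ (ball x (lam * s)) * μ (ball x (lam * s)) := by
        gcongr
    _ = ∫⁻ y in ball x (lam * s), g y ∂μ :=
        ENNReal.div_mul_cancel (h x _ hls).1.ne' (h x _ hls).2.2.ne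
    _ ≤ ∫⁻ y in Ω, g y ∂μ := lintegral_mono_set (ball_subset_closedBall.trans hΩ)

theorem min_measure_le_lintegral_indicator_sub {Y : Type*} [MeasurableSpace Y]
    {μ : Measure Y} {E B : Set Y} (hE : MeasurableSet E)
    (c : ℝ) :
    min (μ (B ∩ E)) (μ (B \ E)) ≤
      ∫⁻ y in B, ENNReal.ofReal |E.indicator (fun _ => (1 : ℝ)) y - c| ∂μ := by
  have hEc : ∫⁻ y in B ∩ E, ENNReal.ofReal |E.indicator (fun _ => (1 : ℝ)) y - c| ∂μ =
      ENNReal.ofReal |1 - c| * μ (B ∩ E) := by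
    rw [inter_comm, ← Measure.restrict_restrict hE, ← Measure.restrict_apply hE,
      ← setLIntegral_const]
    exact setLIntegral_congr_fun hE fun y hy => by simp only [indicator_of_mem hy]
  have hEcc : ∫⁻ y in B \ E, ENNReal.ofReal |E.indicator (fun _ => (1 : ℝ)) y - c| ∂μ =
      ENNReal.ofReal |c| * μ (B \ E) := by
    rw [sdiff_eq, inter_comm, ← Measure.restrict_restrict hE.compl,
      ← Measure.restrict_apply hE.compl, ← setLIntegral_const]
    exact setLIntegral_congr_fun hE.compl fun y hy => by
      simp only [indicator_of_notMem hy, zero_sub, abs_neg]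
  rw [← lintegral_inter_add_sdiff _ B hE, hEc, hEcc]
  have hone : (1 : ℝ≥0∞) ≤ ENNReal.ofReal |1 - c| + ENNReal.ofReal |c| := by
    rw [← ENNReal.ofReal_add (abs_nonneg _) (abs_nonneg _), ENNReal.one_le_ofReal]
    linarith [le_abs_self (1 - c), le_abs_self c]
  calc min (μ (B ∩ E)) (μ (B \ E))
      ≤ (ENNReal.ofReal |1 - c| + ENNReal.ofReal |c|) * min (μ (B ∩ E)) (μ (B \ E)) :=
        le_mul_of_one_le_left' hone
    _ ≤ _ := by
        rw [add_mul]
        gcongr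
        · exact min_le_left _ _
        · exact min_le_right _ _

theorem PoincareIneq.min_measure_le_mul_perimeter [CompleteSpace X] [BorelSpace X]
    {CP lam : ℝ} (hP : PoincareIneq μ CP lam) (h : DoublingWith μ Cd) (hCP : 0 < CP)
    (hlam : 1 ≤ lam) {x : X} {s : ℝ} (hs : 0 < s) {Ω : Set X}
    (hΩ : closedBall x (lam * s) ⊆ Ω) {E : Set X} (hE : MeasurableSet E) :
    min (μ (ball x s ∩ E)) (μ (ball x s \ E)) ≤
      ENNReal.ofReal (CP * s) * perimeter μ E Ω := by
  have ha₀ : ENNReal.ofReal (CP * s) ≠ 0 := (ENNReal.ofReal_pos.2 (by positivity)).ne'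
  rw [← ENNReal.div_le_iff' ha₀ ENNReal.ofReal_ne_top]
  refine le_iInf fun v => le_iInf fun g => le_iInf fun hv => le_iInf fun hg =>
    le_iInf fun hconv => ?_
  set a := ENNReal.ofReal (CP * s)
  set m := min (μ (ball x s ∩ E)) (μ (ball x s \ E))
  set K := closedBall x (lam * s)
  have hK : IsCompact K := h.isCompact_closedBall x (by positivity)
  have hball : ball x s ⊆ K := ball_subset_closedBall.trans (closedBall_subset_closedBall
    (by nlinarith))
  set e : ℕ → ℝ≥0∞ := fun i =>
    ∫⁻ y in K, ENNReal.ofReal |v i y - E.indicator (fun _ => (1 : ℝ)) y| ∂μ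
  have he : Tendsto e atTop (𝓝 0) := hconv K hΩ hK
  have hle : ∀ i, m ≤ e i + a * ∫⁻ y in Ω, g i y ∂μ := by
    intro i
    obtain ⟨c, hc⟩ := hP.exists_lintegral_sub_const_le h hlam hs hΩ (hv i) (hg i)
    obtain ⟨L, hL⟩ := hv i K hΩ hK
    have hvm : AEMeasurable (v i) (μ.restrict (ball x s)) :=
      (hL.continuousOn.mono hball).aemeasurable measurableSet_ball
    calc m ≤ ∫⁻ y in ball x s, ENNReal.ofReal |E.indicator (fun _ => (1 : ℝ)) y - c| ∂μ :=
          min_measure_le_lintegral_indicator_sub hE c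
      _ ≤ ∫⁻ y in ball x s, (ENNReal.ofReal |v i y - E.indicator (fun _ => (1 : ℝ)) y| +
            ENNReal.ofReal |v i y - c|) ∂μ := by
          refine lintegral_mono fun y => ?_
          rw [← ENNReal.ofReal_add (abs_nonneg _) (abs_nonneg _), abs_sub_comm (v i y)]
          exact ENNReal.ofReal_le_ofReal (abs_sub_le _ _ _)
      _ = (∫⁻ y in ball x s, ENNReal.ofReal |v i y - E.indicator (fun _ => (1 : ℝ)) y| ∂μ) +
            ∫⁻ y in ball x s, ENNReal.ofReal |v i y - c| ∂μ :=
          lintegral_add_right' _ (hvm.sub_const c).abs.ennreal_ofReal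
      _ ≤ e i + a * ∫⁻ y in Ω, g i y ∂μ := add_le_add (lintegral_mono_set hball) hc
  have hm : m / a ≠ ⊤ := ENNReal.div_ne_top (ne_top_of_le_ne_top (h x s hs).2.2.ne
    ((min_le_left _ _).trans (measure_mono inter_subset_left))) ha₀
  have hlim : Tendsto (fun i => m / a - e i / a) atTop (𝓝 (m / a)) := by
    have := ENNReal.Tendsto.sub (tendsto_const_nhds (x := m / a) (f := atTop))
      (ENNReal.Tendsto.div_const he (Or.inr ha₀)) (Or.inl hm)
    simpa using this
  rw [← hlim.liminf_eq]
  refine liminf_le_liminf (Eventually.of_forall fun i => ?_)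
  rw [tsub_le_iff_left, ENNReal.div_le_iff ha₀ ENNReal.ofReal_ne_top, add_mul,
    ENNReal.div_mul_cancel ha₀ ENNReal.ofReal_ne_top, mul_comm _ a]
  exact hle i

/-- **Relative isoperimetric inequality.** There is a constant `C ≥ 1`, depending
only on `Cd`, `CP`, `lam`, such that
`min{μ(B(x,r) ∩ E), μ(B(x,r) ∖ E)} ≤ C r P(E, B(x,λr))`. -/
theorem relative_isoperimetric_inequality
    (Cd : ℝ≥0) (CP lam : ℝ) (hCd : 1 ≤ Cd) (hCP : 0 < CP) (hlam : 1 ≤ lam) :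
    ∃ C : ℝ≥0, 1 ≤ C ∧
      ∀ (X : Type) [MetricSpace X] [CompleteSpace X] [Nontrivial X]
        [MeasurableSpace X] [BorelSpace X] (μ : Measure X),
        DoublingWith μ Cd → PoincareIneq μ CP lam →
        ∀ (x : X) (r : ℝ), 0 < r → ∀ E : Set X, MeasurableSet E →
          min (μ (ball x r ∩ E)) (μ (ball x r \ E)) ≤
            (C : ℝ≥0∞) * ENNReal.ofReal r * perimeter μ E (ball x (lam * r)) := by
  refine ⟨max 1 CP.toNNReal, le_max_left _ _, ?_⟩
  intro X _ _ _ _ _ μ hd hP x r hr E hE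
  obtain ⟨s, hmono, hs, hlim⟩ := exists_seq_strictMono_tendsto' hr
  have hUnion : ⋃ n, ball x (s n) = ball x r := by
    refine Subset.antisymm (iUnion_subset fun n => ball_subset_ball (hs n).2.le) fun y hy => ?_
    obtain ⟨n, hn⟩ := (hlim.eventually_const_lt (mem_ball.1 hy)).exists
    exact mem_iUnion.2 ⟨n, hn⟩
  have hball : Monotone fun n => ball x (s n) :=
    fun m n hmn => ball_subset_ball (hmono.monotone hmn)
  have hin : Tendsto (fun n => μ (ball x (s n) ∩ E)) atTop (𝓝 (μ (ball x r ∩ E))) := by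
    rw [← hUnion, iUnion_inter]
    exact tendsto_measure_iUnion_atTop fun m n hmn => inter_subset_inter_left _ (hball hmn)
  have hout : Tendsto (fun n => μ (ball x (s n) \ E)) atTop (𝓝 (μ (ball x r \ E))) := by
    rw [← hUnion, iUnion_sdiff]
    exact tendsto_measure_iUnion_atTop fun m n hmn => sdiff_subset_sdiff_left (hball hmn)
  refine le_of_tendsto' (hin.min hout) fun n => ?_
  refine (hP.min_measure_le_mul_perimeter hd hCP hlam (hs n).1
    (closedBall_subset_ball (mul_lt_mul_of_pos_left (hs n).2 (by positivity))) hE).trans ?_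
  rw [ENNReal.ofReal_mul hCP.le]
  gcongr
  · exact ENNReal.coe_le_coe.2 (le_max_right _ _)
  · exact (hs n).2.le

end FineBV
end
end

section
/- Let u ∈ BV(X) and suppose u ≥ 0, u ≥ 1 in a neighborhood of a set G ⊂ X. Let v_i, i ∈ ℕ, be discrete convolutions of u at scales 1/i, and let N ⊂ X, with H(N) = 0, be the set where the pointwise convergence estimate (1−γ̃)u^∧(y) + γ̃u^∨(y) ≤ liminf_i v_i(y) ≤ limsup_i v_i(y) ≤ γ̃u^∧(y) + (1−γ̃)u^∨(y) fails (γ̃ ∈ (0,1/2] depending only on C_d, C_P, λ). Then liminf_{i→∞} v_i(y) ≥ γ̃ for every y ∈ (G ∪ I_G ∪ ∂*G) ∖ N. -/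
open MeasureTheory Metric Set Filter Topology ENNReal NNReal

noncomputable section

namespace FineBV

variable {X : Type*} [MetricSpace X] [MeasurableSpace X]

/-- The lower approximate limit of a nonnegative function is nonnegative. -/
lemma lowerApprox_nonneg (μ : Measure X) {u : X → ℝ} (hu : ∀ x, 0 ≤ u x) (y : X) :
    0 ≤ lowerApprox μ u y := by
  refine le_sSup ?_
  simp [(hu _).not_gt]

/-- If `a ≤ u` on a set that does not have density zero at `y`, then `a ≤ u^∨(y)`. -/
lemma le_upperApprox_of_not_tendsto {μ : Measure X} {u : X → ℝ} {A : Set X} {a : EReal} {y : X}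
    (hA : ∀ x ∈ A, a ≤ (u x : EReal))
    (h : ¬ Tendsto (fun r : ℝ => μ (ball y r ∩ A) / μ (ball y r)) (𝓝[>] 0) (𝓝 0)) :
    a ≤ upperApprox μ u y := by
  refine le_sInf fun t ht => ?_
  by_contra! hta
  refine h (tendsto_of_tendsto_of_tendsto_of_le_of_le tendsto_const_nhds ht
    (fun _ => zero_le) fun r => ?_)
  exact ENNReal.div_le_div_right
    (measure_mono (inter_subset_inter_right _ fun z hz => hta.trans_le (hA z hz))) _

/-- For a doubling measure, a set whose complement has density zero at `y` does not have
density zero at `y`. -/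
lemma DoublingWith.not_tendsto_of_mem_measInterior {μ : Measure X} {Cd : ℝ≥0}
    (hdbl : DoublingWith μ Cd) {A : Set X} {y : X} (hy : y ∈ measInterior μ A) :
    ¬ Tendsto (fun r : ℝ => μ (ball y r ∩ A) / μ (ball y r)) (𝓝[>] 0) (𝓝 0) := by
  intro h
  have hsum := h.add (mem_ofPred_eq.mp hy)
  rw [add_zero] at hsum
  have hone : ∀ᶠ r : ℝ in 𝓝[>] 0,
      1 ≤ μ (ball y r ∩ A) / μ (ball y r) + μ (ball y r \ A) / μ (ball y r) := by
    filter_upwards [self_mem_nhdsWithin] with r hr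
    obtain ⟨hpos, -, hfin⟩ := hdbl y r hr
    rw [← ENNReal.add_div, ← ENNReal.div_self hpos.ne' hfin.ne]
    exact ENNReal.div_le_div_right (measure_le_inter_add_sdiff μ _ _) _
  exact absurd (ge_of_tendsto hsum hone) (by simp)

/-- Open sets are contained in their measure-theoretic interior. -/
lemma subset_measInterior_of_isOpen (μ : Measure X) {V : Set X} (hV : IsOpen V) :
    V ⊆ measInterior μ V := by
  intro y hy
  obtain ⟨ε, hε, hball⟩ := Metric.isOpen_iff.mp hV y hy
  refine tendsto_const_nhds.congr' ?_
  filter_upwards [Ioo_mem_nhdsGT hε] with r hr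
  simp [sdiff_eq_empty.mpr ((ball_subset_ball hr.2.le).trans hball)]

/-- If `u ∈ BV(X)` with `u ≥ 0` and `u ≥ 1` in a neighborhood of `G`, and `v_i`
are discrete convolutions of `u` at scales `1/i`, with `N` the `H`-null set where
the pointwise estimate
`(1−γ̃)u^∧ + γ̃u^∨ ≤ liminf v_i ≤ limsup v_i ≤ γ̃u^∧ + (1−γ̃)u^∨` fails, then
`liminf_i v_i(y) ≥ γ̃` for every `y ∈ (G ∪ I_G ∪ ∂*G) ∖ N`. -/
theorem liminf_discrete_convolutions_ge
    {X : Type*} [MetricSpace X] [CompleteSpace X] [Nontrivial X]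
    [MeasurableSpace X] [BorelSpace X] (μ : Measure X)
    (Cd : ℝ≥0) (hCd : 1 ≤ Cd) (hdbl : DoublingWith μ Cd)
    (CP lam : ℝ) (hCP : 0 < CP) (hlam : 1 ≤ lam) (hPI : PoincareIneq μ CP lam)
    (γt : ℝ) (hγt0 : 0 < γt) (hγthalf : γt ≤ 1 / 2)
    (u : X → ℝ) (hu : MemBV μ u) (hu0 : ∀ x, 0 ≤ u x)
    (G : Set X) (hG : ∃ V : Set X, IsOpen V ∧ G ⊆ V ∧ ∀ x ∈ V, 1 ≤ u x)
    (v : ℕ → X → ℝ)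
    (hv : ∀ i : ℕ, IsDiscreteConvolution μ lam (1 / (i + 1 : ℝ)) u (v i))
    (N : Set X)
    (hNdef : N = {y : X |
      ¬ (((1 - γt : ℝ) : EReal) * lowerApprox μ u y +
            ((γt : ℝ) : EReal) * upperApprox μ u y ≤
          Filter.liminf (fun i => ((v i y : ℝ) : EReal)) atTop ∧
        Filter.limsup (fun i => ((v i y : ℝ) : EReal)) atTop ≤
          ((γt : ℝ) : EReal) * lowerApprox μ u y +
            ((1 - γt : ℝ) : EReal) * upperApprox μ u y)})
    (hN : codimH μ N = 0) :
    ∀ y ∈ (G ∪ measInterior μ G ∪ measBoundary μ G) \ N,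
      ((γt : ℝ) : EReal) ≤ Filter.liminf (fun i => ((v i y : ℝ) : EReal)) atTop := by
  obtain ⟨V, hVo, hGV, hV⟩ := hG
  rintro y ⟨hy, hyN⟩
  have hlower : 0 ≤ lowerApprox μ u y := lowerApprox_nonneg μ hu0 y
  have hupper : 1 ≤ upperApprox μ u y := by
    have hVu : ∀ x ∈ V, (1 : EReal) ≤ (u x : EReal) := fun x hx => by exact_mod_cast hV x hx
    rcases hy with (hy | hy) | hy
    · exact le_upperApprox_of_not_tendsto hVu
        (hdbl.not_tendsto_of_mem_measInterior (subset_measInterior_of_isOpen μ hVo (hGV hy)))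
    · exact le_upperApprox_of_not_tendsto (fun x hx => hVu x (hGV hx))
        (hdbl.not_tendsto_of_mem_measInterior hy)
    · exact le_upperApprox_of_not_tendsto (fun x hx => hVu x (hGV hx))
        fun h => hy.1.ne' h.limsup_eq
  simp only [hNdef, mem_ofPred_eq, not_not] at hyN
  refine le_trans ?_ hyN.1
  have hγ1 : (0 : EReal) ≤ ((1 - γt : ℝ) : EReal) := by
    exact_mod_cast (by linarith : (0 : ℝ) ≤ 1 - γt)
  have hγ0 : (0 : EReal) ≤ (γt : EReal) := by exact_mod_cast hγt0.le
  calc (γt : EReal) = 0 + (γt : EReal) * 1 := by simp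
    _ ≤ _ := add_le_add (mul_nonneg hγ1 hlower) (mul_le_mul_of_nonneg_left hupper hγ0)

end FineBV
end
end
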